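/- Let m < n be natural numbers, let η : B_m → B_n be the standard geometric embedding, let g ∈ B_n, and let φ : B_m → B_n be the homomorphism defined by φ(x) = g⁻¹·η(x)·g for all x ∈ B_m (so that g·φ(x)·g⁻¹ = η(x)). Then for every a, b ∈ B_m, if φ(a) and φ(b) are conjugate in B_n, then a and b are conjugate in B_m. -/

import Mathlib

/-- The braid relations on generators `σ_1, …, σ_{n-1}`, indexed here by `Fin (n-1)`
(index `i : Fin (n-1)` corresponds to `σ_{i+1}`): far-apart generators commute, and
adjacent generators satisfy the braid relation. -/
def braidRels (n : ℕ) : Set (FreeGroup (Fin (n - 1))) :=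
  { r | (∃ i j : Fin (n - 1), (i : ℕ) + 1 < (j : ℕ) ∧
          r = FreeGroup.of i * FreeGroup.of j * (FreeGroup.of i)⁻¹ * (FreeGroup.of j)⁻¹) ∨
        (∃ i j : Fin (n - 1), (j : ℕ) = (i : ℕ) + 1 ∧
          r = FreeGroup.of i * FreeGroup.of j * FreeGroup.of i *
              (FreeGroup.of j * FreeGroup.of i * FreeGroup.of j)⁻¹) }

/-- The braid group `B_n` on `n` strands, presented by generators and braid relations. -/
abbrev BraidGroup (n : ℕ) : Type := PresentedGroup (braidRels n)

/-- The Artin generator `σ_{i+1}` of `B_n`, for `i : Fin (n-1)`. -/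
def braidGen (n : ℕ) (i : Fin (n - 1)) : BraidGroup n := PresentedGroup.of i

namespace BraidGroup

/-- The Artin generators indexed by `ℕ`, with value `1` out of range. -/
def gen (n i : ℕ) : BraidGroup n := if h : i < n - 1 then braidGen n ⟨i, h⟩ else 1

theorem gen_of_lt {n i : ℕ} (h : i < n - 1) : gen n i = braidGen n ⟨i, h⟩ := dif_pos h

theorem gen_of_ge {n i : ℕ} (h : ¬ i < n - 1) : gen n i = 1 := dif_neg h

theorem gen_comm {n i j : ℕ} (hij : i + 1 < j) : gen n i * gen n j = gen n j * gen n i := by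
  by_cases hj : j < n - 1
  · have hi : i < n - 1 := by omega
    rw [gen_of_lt hj, gen_of_lt hi]
    have := PresentedGroup.one_of_mem (rels := braidRels n) (Or.inl ⟨⟨i, hi⟩, ⟨j, hj⟩, hij, rfl⟩)
    simp only [map_mul, map_inv, mul_inv_eq_iff_eq_mul, one_mul] at this
    exact this
  · simp [gen_of_ge hj]

theorem gen_braid {n i : ℕ} (hi : i + 1 < n - 1) :
    gen n i * gen n (i + 1) * gen n i = gen n (i + 1) * gen n i * gen n (i + 1) := by
  have hi' : i < n - 1 := by omega
  rw [gen_of_lt hi, gen_of_lt hi']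
  have := PresentedGroup.one_of_mem (rels := braidRels n)
    (Or.inr ⟨⟨i, hi'⟩, ⟨i + 1, hi⟩, rfl, rfl⟩)
  simp only [map_mul, map_inv, mul_inv_eq_one] at this
  exact this

@[elab_as_elim]
theorem induction_gen {n : ℕ} {motive : BraidGroup n → Prop} (x : BraidGroup n)
    (one : motive 1) (gen : ∀ i, i + 1 < n → motive (gen n i))
    (mul : ∀ x y, motive x → motive y → motive (x * y))
    (inv : ∀ x, motive x → motive x⁻¹) : motive x := by
  have hx : x ∈ Subgroup.closure (Set.range (PresentedGroup.of (rels := braidRels n))) := by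
    rw [PresentedGroup.closure_range_of]; trivial
  induction hx using Subgroup.closure_induction with
  | mem y hy =>
    obtain ⟨i, rfl⟩ := hy
    have := gen i (by omega)
    rwa [gen_of_lt i.2] at this
  | one => exact one
  | mul x y _ _ hx hy => exact mul x y hx hy
  | inv x _ hx => exact inv x hx

/-- A homomorphism out of the braid group from a family satisfying the braid relations. -/
def lift {G : Type*} [Group G] (n : ℕ) (f : ℕ → G)
    (comm : ∀ i j, i + 1 < j → j + 1 < n → f i * f j = f j * f i)
    (braid : ∀ i, i + 2 < n → f i * f (i + 1) * f i = f (i + 1) * f i * f (i + 1)) :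
    BraidGroup n →* G :=
  PresentedGroup.toGroup (f := fun i : Fin (n - 1) => f i) (by
    rintro r (⟨i, j, hij, rfl⟩ | ⟨i, j, hij, rfl⟩)
    · simpa only [map_mul, map_inv, FreeGroup.lift_apply_of, mul_inv_eq_iff_eq_mul,
        one_mul] using comm i j hij (by omega)
    · simpa only [map_mul, map_inv, FreeGroup.lift_apply_of, mul_inv_eq_one, hij] using
        braid i (by omega))

theorem lift_gen {G : Type*} [Group G] {n : ℕ} {f : ℕ → G} {comm braid} {i : ℕ}
    (hi : i + 1 < n) : lift n f comm braid (gen n i) = f i := by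
  rw [gen_of_lt (by omega)]
  exact PresentedGroup.toGroup.of _

/-- The standard embedding `B_n → B_{n+1}`. -/
def incl (n : ℕ) : BraidGroup n →* BraidGroup (n + 1) :=
  lift n (gen (n + 1)) (fun _ _ h _ => gen_comm h) (fun _ h => gen_braid (by omega))

theorem incl_gen {n i : ℕ} (hi : i + 1 < n) : incl n (gen n i) = gen (n + 1) i := lift_gen hi

theorem swap_comm {i j : ℕ} (h : i + 1 < j) :
    Equiv.swap i (i + 1) * Equiv.swap j (j + 1) = Equiv.swap j (j + 1) * Equiv.swap i (i + 1) := by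
  ext p
  simp only [Equiv.Perm.mul_apply, Equiv.swap_apply_def]
  grind

theorem swap_braid (i : ℕ) :
    Equiv.swap i (i + 1) * Equiv.swap (i + 1) (i + 1 + 1) * Equiv.swap i (i + 1) =
      Equiv.swap (i + 1) (i + 1 + 1) * Equiv.swap i (i + 1) * Equiv.swap (i + 1) (i + 1 + 1) := by
  ext p
  simp only [Equiv.Perm.mul_apply, Equiv.swap_apply_def]
  grind

/-- The permutation of strand positions induced by a braid. -/
def perm (n : ℕ) : BraidGroup n →* Equiv.Perm ℕ :=
  lift n (fun i => Equiv.swap i (i + 1))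
    (fun _ _ h _ => swap_comm h) (fun i _ => swap_braid i)

theorem perm_gen {n i : ℕ} (hi : i + 1 < n) : perm n (gen n i) = Equiv.swap i (i + 1) :=
  lift_gen hi

theorem perm_lt_iff {n : ℕ} (x : BraidGroup n) : ∀ j, perm n x j < n ↔ j < n := by
  induction x using induction_gen with
  | one => simp
  | gen i hi => intro j; rw [perm_gen hi, Equiv.swap_apply_def]; grind
  | mul x y hx hy => intro j; rw [map_mul, Equiv.Perm.mul_apply, hx, hy]
  | inv x hx => intro j; rw [← hx, map_inv]; simp

theorem perm_incl {n : ℕ} (x : BraidGroup n) : perm (n + 1) (incl n x) = perm n x := by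
  induction x using induction_gen with
  | one => simp
  | gen i hi => rw [incl_gen hi, perm_gen hi, perm_gen (by omega)]
  | mul x y hx hy => simp only [map_mul, hx, hy]
  | inv x hx => simp only [map_inv, hx]

theorem perm_apply_of_ge {n : ℕ} (x : BraidGroup n) : ∀ j, n ≤ j → perm n x j = j := by
  induction x using induction_gen with
  | one => simp
  | gen i hi => intro j hj; rw [perm_gen hi, Equiv.swap_apply_def]; grind
  | mul x y hx hy => intro j hj; rw [map_mul, Equiv.Perm.mul_apply, hy j hj, hx j hj]
  | inv x hx => intro j hj; rw [map_inv, Equiv.Perm.inv_eq_iff_eq, hx j hj]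

/-- What remains of the generator `σ_i` of `B_{n+1}` after deleting the strand that starts at
position `j`. -/
def deleteGen (n i j : ℕ) : BraidGroup n :=
  if j < i then gen n (i - 1) else if i + 1 < j ∧ j ≤ n then gen n i else 1

theorem deleteGen_of_lt {n i j : ℕ} (h : j < i) : deleteGen n i j = gen n (i - 1) := if_pos h

theorem deleteGen_left (n i : ℕ) : deleteGen n i i = 1 := by
  rw [deleteGen, if_neg (by omega), if_neg (by omega)]

theorem deleteGen_right (n i : ℕ) : deleteGen n i (i + 1) = 1 := by
  rw [deleteGen, if_neg (by omega), if_neg (by omega)]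

theorem deleteGen_of_gt {n i j : ℕ} (h : i + 1 < j) (hj : j ≤ n) :
    deleteGen n i j = gen n i := by
  rw [deleteGen, if_neg (by omega), if_pos ⟨h, hj⟩]

theorem deleteGen_of_last_lt {n i j : ℕ} (hi : i < n) (hj : n < j) : deleteGen n i j = 1 := by
  rw [deleteGen, if_neg (by omega), if_neg (by omega)]

theorem deleteGen_swap_of_lt {n i j : ℕ} (h : i + 1 < j) (hj : j < n) (p : ℕ) :
    deleteGen n i (Equiv.swap j (j + 1) p) = deleteGen n i p := by
  rw [deleteGen, deleteGen, Equiv.swap_apply_def]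
  split_ifs <;> first | rfl | omega

theorem deleteGen_swap_of_gt {n i j : ℕ} (h : i + 1 < j) (p : ℕ) :
    deleteGen n j (Equiv.swap i (i + 1) p) = deleteGen n j p := by
  rw [deleteGen, deleteGen, Equiv.swap_apply_def]
  split_ifs <;> first | rfl | omega

theorem deleteGen_comm {n i j : ℕ} (h : i + 1 < j) (p : ℕ) :
    deleteGen n i p * deleteGen n j p = deleteGen n j p * deleteGen n i p := by
  rcases lt_trichotomy p i with hp | rfl | hp
  · rw [deleteGen_of_lt hp, deleteGen_of_lt (by omega), gen_comm (by omega)]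
  · simp [deleteGen_left]
  · by_cases hp' : i + 1 < p ∧ p ≤ n
    · rw [deleteGen_of_gt hp'.1 hp'.2, deleteGen]
      split_ifs
      · exact gen_comm (by omega)
      · exact gen_comm h
      · simp
    · rw [deleteGen, if_neg (by omega), if_neg hp', one_mul, mul_one]

theorem deleteGen_braid {n i : ℕ} (hi : i + 1 < n) (p : ℕ) :
    deleteGen n i (Equiv.swap (i + 1) (i + 1 + 1) (Equiv.swap i (i + 1) p)) *
        deleteGen n (i + 1) (Equiv.swap i (i + 1) p) * deleteGen n i p =
      deleteGen n (i + 1) (Equiv.swap i (i + 1) (Equiv.swap (i + 1) (i + 1 + 1) p)) *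
        deleteGen n i (Equiv.swap (i + 1) (i + 1 + 1) p) * deleteGen n (i + 1) p := by
  rcases lt_trichotomy p i with hp | rfl | hp
  · simp only [Equiv.swap_apply_of_ne_of_ne (show p ≠ i by omega) (show p ≠ i + 1 by omega),
      Equiv.swap_apply_of_ne_of_ne (show p ≠ i + 1 by omega) (show p ≠ i + 1 + 1 by omega)]
    rw [deleteGen_of_lt hp, deleteGen_of_lt (by omega)]
    obtain ⟨k, rfl⟩ : ∃ k, i = k + 1 := ⟨i - 1, by omega⟩
    exact gen_braid (by omega)
  · rw [Equiv.swap_apply_left, Equiv.swap_apply_left,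
      Equiv.swap_apply_of_ne_of_ne (show p ≠ p + 1 by omega) (show p ≠ p + 1 + 1 by omega),
      Equiv.swap_apply_left, deleteGen_of_gt (by omega) (by omega), deleteGen_left,
      deleteGen_left, deleteGen_of_lt (by omega)]
    simp
  rcases lt_trichotomy p (i + 1 + 1) with hp' | rfl | hp'
  · obtain rfl : p = i + 1 := by omega
    rw [Equiv.swap_apply_right, Equiv.swap_apply_left,
      Equiv.swap_apply_of_ne_of_ne (show i ≠ i + 1 by omega) (show i ≠ i + 1 + 1 by omega),
      Equiv.swap_apply_of_ne_of_ne (show i + 1 + 1 ≠ i by omega)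
        (show i + 1 + 1 ≠ i + 1 by omega), deleteGen_left, deleteGen_right, deleteGen_right,
      deleteGen_left, deleteGen_of_lt (by omega), deleteGen_of_gt (by omega) (by omega)]
    simp
  · rw [Equiv.swap_apply_of_ne_of_ne (show i + 1 + 1 ≠ i by omega)
        (show i + 1 + 1 ≠ i + 1 by omega), Equiv.swap_apply_right, Equiv.swap_apply_right,
      deleteGen_right, deleteGen_right,
      deleteGen_of_gt (by omega) (by omega), deleteGen_of_lt (by omega)]
    simp
  · simp only [Equiv.swap_apply_of_ne_of_ne (show p ≠ i by omega) (show p ≠ i + 1 by omega),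
      Equiv.swap_apply_of_ne_of_ne (show p ≠ i + 1 by omega) (show p ≠ i + 1 + 1 by omega)]
    by_cases hpn : p ≤ n
    · rw [deleteGen_of_gt (by omega) hpn, deleteGen_of_gt (by omega) hpn]
      exact gen_braid (by omega)
    · rw [deleteGen_of_last_lt (by omega) (by omega), deleteGen_of_last_lt hi (by omega)]

/-- The action of `B_{n+1}` on pairs of a marked position and a braid on the other strands. -/
def markedAction (n : ℕ) : BraidGroup (n + 1) →* Equiv.Perm (ℕ × BraidGroup n) :=
  lift (n + 1)
    (fun i => Equiv.prodShear (Equiv.swap i (i + 1)) fun j => Equiv.mulLeft (deleteGen n i j))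
    (fun i j h hj => by
      ext1 ⟨p, w⟩
      simp only [Equiv.Perm.mul_apply, Equiv.prodShear_apply, Equiv.coe_mulLeft, ← mul_assoc]
      rw [deleteGen_swap_of_lt h (by omega), deleteGen_swap_of_gt h, deleteGen_comm h]
      exact congrArg (·, _) (DFunLike.congr_fun (swap_comm h) p))
    (fun i hi => by
      ext1 ⟨p, w⟩
      simp only [Equiv.Perm.mul_apply, Equiv.prodShear_apply, Equiv.coe_mulLeft, ← mul_assoc]
      rw [deleteGen_braid (by omega)]
      exact congrArg (·, _) (DFunLike.congr_fun (swap_braid i) p))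

theorem markedAction_gen {n i : ℕ} (hi : i < n) (j : ℕ) (w : BraidGroup n) :
    markedAction n (gen (n + 1) i) (j, w) = (Equiv.swap i (i + 1) j, deleteGen n i j * w) := by
  rw [markedAction, lift_gen (by omega)]
  rfl

/-- The braid obtained by deleting the strand that starts at position `j`. -/
def delete {n : ℕ} (x : BraidGroup (n + 1)) (j : ℕ) : BraidGroup n := (markedAction n x (j, 1)).2

theorem markedAction_apply {n : ℕ} (x : BraidGroup (n + 1)) :
    ∀ j w, markedAction n x (j, w) = (perm (n + 1) x j, delete x j * w) := by
  induction x using induction_gen with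
  | one => simp [delete]
  | gen i hi =>
    intro j w
    rw [delete, markedAction_gen (by omega), markedAction_gen (by omega), perm_gen hi, mul_one]
  | mul x y hx hy =>
    intro j w
    have key : ∀ v, markedAction n (x * y) (j, v) =
        (perm (n + 1) (x * y) j, delete x (perm (n + 1) y j) * delete y j * v) := by
      intro v
      simp only [map_mul, Equiv.Perm.mul_apply, hy, hx, mul_assoc]
    rw [delete, key, key, mul_one]
  | inv x hx =>
    intro j w
    have key : ∀ v, markedAction n x⁻¹ (j, v) =
        (perm (n + 1) x⁻¹ j, (delete x (perm (n + 1) x⁻¹ j))⁻¹ * v) := by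
      intro v
      rw [map_inv, Equiv.Perm.inv_eq_iff_eq, hx]
      simp
    rw [delete, key, key, mul_one]

theorem delete_one {n : ℕ} (j : ℕ) : delete (1 : BraidGroup (n + 1)) j = 1 := by
  simp [delete]

theorem delete_mul {n : ℕ} (x y : BraidGroup (n + 1)) (j : ℕ) :
    delete (x * y) j = delete x (perm (n + 1) y j) * delete y j := by
  rw [delete, map_mul, Equiv.Perm.mul_apply, markedAction_apply, markedAction_apply, mul_one]

theorem delete_inv {n : ℕ} (x : BraidGroup (n + 1)) (j : ℕ) :
    delete x⁻¹ j = (delete x (perm (n + 1) x⁻¹ j))⁻¹ := by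
  refine eq_inv_of_mul_eq_one_right ?_
  rw [← delete_mul, mul_inv_cancel, delete_one]

theorem delete_gen {n i : ℕ} (hi : i < n) (j : ℕ) :
    delete (gen (n + 1) i) j = deleteGen n i j := by
  rw [delete, markedAction_gen hi, mul_one]

theorem delete_incl_last {n : ℕ} (x : BraidGroup n) : delete (incl n x) n = x := by
  induction x using induction_gen with
  | one => simp [delete_one]
  | gen i hi =>
    rw [incl_gen hi, delete_gen (by omega), deleteGen, if_neg (by omega), if_pos (by omega)]
  | mul x y hx hy =>
    rw [map_mul, delete_mul, perm_incl, perm_apply_of_ge y n le_rfl, hx, hy]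
  | inv x hx =>
    rw [map_inv, delete_inv, ← map_inv, perm_incl, perm_apply_of_ge _ n le_rfl, hx]

theorem delete_incl {n : ℕ} (x : BraidGroup (n + 1)) :
    ∀ j ≤ n, delete (incl (n + 1) x) j = incl n (delete x j) := by
  induction x using induction_gen with
  | one => simp [delete_one]
  | gen i hi =>
    intro j hj
    rw [incl_gen hi, delete_gen (by omega), delete_gen (by omega), deleteGen, deleteGen]
    split_ifs
    · rw [incl_gen (by omega)]
    · rw [incl_gen (by omega)]
    all_goals first | omega | simp
  | mul x y hx hy =>
    intro j hj
    have := (perm_lt_iff y j).2 (by omega)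
    rw [map_mul, delete_mul, perm_incl, delete_mul, map_mul, hx _ (by omega), hy j hj]
  | inv x hx =>
    intro j hj
    have := (perm_lt_iff x⁻¹ j).2 (by omega)
    rw [map_inv, delete_inv, ← map_inv (incl (n + 1)), perm_incl, delete_inv, map_inv (incl n),
      hx _ (by omega)]

/-- The position of the strand `k` once the strand `j` has been deleted. -/
def relabel (j k : ℕ) : ℕ := if k < j then k else k - 1

theorem perm_delete {n : ℕ} (x : BraidGroup (n + 1)) : ∀ j k, j ≤ n → k ≤ n → j ≠ k →
    perm n (delete x j) (relabel j k) = relabel (perm (n + 1) x j) (perm (n + 1) x k) := by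
  induction x using induction_gen with
  | one => simp [delete_one]
  | gen i hi =>
    intro j k hj hk hjk
    rw [delete_gen (by omega), deleteGen, perm_gen hi]
    split_ifs
    · rw [perm_gen (by omega)]
      simp only [relabel, Equiv.swap_apply_def]
      grind
    · rw [perm_gen (by omega)]
      simp only [relabel, Equiv.swap_apply_def]
      grind
    · rw [map_one, Equiv.Perm.one_apply]
      simp only [relabel, Equiv.swap_apply_def]
      grind
  | mul x y hx hy =>
    intro j k hj hk hjk
    have h1 := (perm_lt_iff y j).2 (by omega)
    have h2 := (perm_lt_iff y k).2 (by omega)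
    rw [delete_mul, map_mul, Equiv.Perm.mul_apply, hy j k hj hk hjk,
      hx _ _ (by omega) (by omega) (by simpa using hjk)]
    simp
  | inv x hx =>
    intro j k hj hk hjk
    have h1 := (perm_lt_iff x⁻¹ j).2 (by omega)
    have h2 := (perm_lt_iff x⁻¹ k).2 (by omega)
    rw [delete_inv, map_inv, Equiv.Perm.inv_eq_iff_eq,
      hx _ _ (by omega) (by omega) (by simpa using hjk)]
    simp

/-- A braid with a trivial last strand conjugated so that this strand moves away is, after
deletion of the strand replacing it, conjugate to a braid with one more trivial strand. -/
theorem delete_mul_incl_delete {n : ℕ} {a b : BraidGroup (n + 1)} {g : BraidGroup (n + 2)}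
    (h : g * incl (n + 1) a = incl (n + 1) b * g) {q : ℕ} (hq : q ≤ n)
    (hgq : perm (n + 2) g q = n + 1) :
    delete g q * incl n (delete a q) = b * delete g q := by
  have hp : perm (n + 1) a q = q := by
    have := congrArg (fun x => perm (n + 2) x q) h
    simp only [map_mul, Equiv.Perm.mul_apply, perm_incl, hgq,
      perm_apply_of_ge b (n + 1) le_rfl] at this
    exact (perm (n + 2) g).injective (this.trans hgq.symm)
  have := congrArg (fun x => delete x q) h
  simpa only [delete_mul, perm_incl, hp, delete_incl a q hq, hgq, delete_incl_last] using this

theorem isConj_of_isConj_incl {n : ℕ} {a b : BraidGroup n}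
    (h : IsConj (incl n a) (incl n b)) : IsConj a b := by
  obtain ⟨g, hg⟩ := isConj_iff.1 h
  replace hg : g * incl n a = incl n b * g := mul_inv_eq_iff_eq_mul.1 hg
  by_cases hn : perm (n + 1) g n = n
  · have := congrArg (fun x => delete x n) hg
    simp only [delete_mul, perm_incl, perm_apply_of_ge a n le_rfl, delete_incl_last, hn] at this
    exact isConj_iff.2 ⟨delete g n, mul_inv_eq_iff_eq_mul.2 this⟩
  obtain _ | n := n
  · have := (perm_lt_iff g 0).2 one_pos
    omega
  change perm (n + 2) g (n + 1) ≠ n + 1 at hn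
  have hp : perm (n + 2) g (n + 1) < n + 2 := (perm_lt_iff g (n + 1)).2 (by omega)
  obtain ⟨q, hq⟩ := (perm (n + 2) g).surjective (n + 1)
  have hqn : q ≤ n := by
    have := (perm_lt_iff g q).1 (by rw [hq]; omega)
    have : q ≠ n + 1 := by rintro rfl; exact hn hq
    omega
  have hb := delete_mul_incl_delete hg hqn hq
  have ha := delete_mul_incl_delete (g := g⁻¹) (a := b) (b := a) (q := perm (n + 2) g (n + 1))
    (by rw [inv_mul_eq_iff_eq_mul, ← mul_assoc, hg, mul_inv_cancel_right]) (by omega) (by simp)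
  have hab : IsConj (delete a q) (delete b (perm (n + 2) g (n + 1))) := by
    have hn' : perm (n + 1) (delete g q) n = perm (n + 2) g (n + 1) := by
      have : _ = relabel (perm (n + 2) g q) (perm (n + 2) g (n + 1)) :=
        perm_delete g q (n + 1) (by omega) le_rfl (by omega)
      rwa [hq, relabel, relabel, if_neg (by omega), if_pos (by omega)] at this
    have := congrArg (fun x => delete x n) hb
    simp only [delete_mul, perm_incl, perm_apply_of_ge _ n le_rfl, delete_incl_last, hn'] at this
    exact isConj_iff.2 ⟨_, mul_inv_eq_iff_eq_mul.2 this⟩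
  have hb' : IsConj (incl n (delete a q)) b := isConj_iff.2 ⟨_, mul_inv_eq_iff_eq_mul.2 hb⟩
  have ha' : IsConj (incl n (delete b (perm (n + 2) g (n + 1)))) a :=
    isConj_iff.2 ⟨_, mul_inv_eq_iff_eq_mul.2 ha⟩
  exact ha'.symm.trans ((((incl n).map_isConj hab).symm).trans hb')

theorem isConj_of_isConj_map {m n : ℕ} (hmn : m ≤ n) :
    ∀ f : BraidGroup m →* BraidGroup n, (∀ i, i + 1 < m → f (gen m i) = gen n i) →
      ∀ a b, IsConj (f a) (f b) → IsConj a b := by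
  induction n, hmn using Nat.le_induction with
  | base =>
    intro f hf a b h
    have hid : ∀ x, f x = x := fun x => by
      induction x using induction_gen with
      | one => exact map_one f
      | gen i hi => exact hf i hi
      | mul x y hx hy => rw [map_mul, hx, hy]
      | inv x hx => rw [map_inv, hx]
    rwa [hid, hid] at h
  | succ n hmn ih =>
    intro f hf a b h
    let e : BraidGroup m →* BraidGroup n :=
      lift m (gen n) (fun _ _ h _ => gen_comm h) (fun _ h => gen_braid (by omega))
    have he : ∀ i, i + 1 < m → e (gen m i) = gen n i := fun i hi => lift_gen hi
    have hfe : ∀ x, f x = incl n (e x) := fun x => by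
      induction x using induction_gen with
      | one => simp
      | gen i hi => rw [hf i hi, he i hi, incl_gen (by omega)]
      | mul x y hx hy => simp only [map_mul, hx, hy]
      | inv x hx => simp only [map_inv, hx]
    rw [hfe, hfe] at h
    exact ih e he a b (isConj_of_isConj_incl h)

end BraidGroup

/-- A geometric embedding `φ : B_m → B_n`, i.e. a homomorphism that coincides with the
standard geometric embedding `η` up to conjugation by a fixed `g ∈ B_n`
(`φ(x) = g⁻¹·η(x)·g`), does not merge conjugacy classes. -/
theorem geometric_embedding_not_merge_conj (m n : ℕ) (hmn : m < n)
    (η : BraidGroup m →* BraidGroup n)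
    (hη : ∀ i : Fin (m - 1),
      η (braidGen m i) = braidGen n (Fin.castLE (by omega) i))
    (g : BraidGroup n) (φ : BraidGroup m →* BraidGroup n)
    (hφ : ∀ x : BraidGroup m, φ x = g⁻¹ * η x * g)
    (a b : BraidGroup m)
    (h : ∃ α : BraidGroup n, α * φ a * α⁻¹ = φ b) :
    ∃ γ : BraidGroup m, γ * a * γ⁻¹ = b := by
  obtain ⟨α, hα⟩ := h
  refine isConj_iff.1 (BraidGroup.isConj_of_isConj_map hmn.le η (fun i hi => ?_) a b ?_)
  · rw [BraidGroup.gen_of_lt (by omega), BraidGroup.gen_of_lt (by omega), hη]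
    rfl
  · refine isConj_iff.2 ⟨g * α * g⁻¹, ?_⟩
    rw [hφ, hφ] at hα
    calc _ = g * (α * (g⁻¹ * η a * g) * α⁻¹) * g⁻¹ := by group
      _ = η b := by rw [hα]; group
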